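/- Let j be a nonnegative integer and M₀ > 0. There exists a nondecreasing function C : [0,∞) → (0,∞) (depending only on j and M₀) with the following property: if τ is a sufficiently smooth function on [0,1] with M₀^{-1} s ≤ τ(s) ≤ M₀ s for all s ∈ [0,1] and ‖τ'‖_{X^{max(j,2)}} < ∞, f is a sufficiently smooth function on (0,1] with ‖f‖_{X^j} < ∞, and u ∈ L²(0,1) is sufficiently smooth on (0,1] and satisfies τ(s) u'(s) = ∫₀^s f(σ) dσ for all s ∈ (0,1) (equivalently, (τ u')' = f on (0,1) with τ u' vanishing at s = 0), then ‖u‖_{X^{j+2}} ≤ ‖u‖_{L²(0,1)} + C(‖τ'‖_{X^{max(j,2)}}) ‖f‖_{X^j}. -/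

import Mathlib

open MeasureTheory ENNReal RealInnerProductSpace

noncomputable section

/-- The weighted L² norm `‖s^α v‖_{L²(0,1)} = (∫₀¹ s^{2α} ‖v s‖² ds)^{1/2}`, valued in `[0,∞]`. -/
def wL2 {E : Type*} [NormedAddCommGroup E] (α : ℝ) (v : ℝ → E) : ℝ≥0∞ :=
  (∫⁻ s in Set.Ioo (0:ℝ) 1, ENNReal.ofReal (s ^ (2 * α) * ‖v s‖ ^ 2)) ^ ((1:ℝ) / 2)

/-- The weighted L^∞ norm `‖s^α v‖_{L^∞(0,1)} = sup_{0<s<1} s^α ‖v s‖`, valued in `[0,∞]`. -/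
def wLinf {E : Type*} [NormedAddCommGroup E] (α : ℝ) (v : ℝ → E) : ℝ≥0∞ :=
  ⨆ s : Set.Ioo (0:ℝ) 1, ENNReal.ofReal ((s : ℝ) ^ α * ‖v (s : ℝ)‖)

/-- The square of the weighted Sobolev norm `X^m` on `(0,1)`:
for `m = 2k`, `‖u‖_{X^m}² = Σ_{i=0}^{k} ‖∂^i u‖² + Σ_{j=1}^{k} ‖s^j ∂^{k+j} u‖²`;
for `m = 2k+1`, `‖u‖_{X^m}² = Σ_{i=0}^{k} ‖∂^i u‖² + Σ_{j=1}^{k+1} ‖s^{j-1/2} ∂^{k+j} u‖²`. -/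
def XnormSq {E : Type*} [NormedAddCommGroup E] [NormedSpace ℝ E] (m : ℕ) (u : ℝ → E) : ℝ≥0∞ :=
  if m % 2 = 0 then
    (∑ i ∈ Finset.range (m / 2 + 1), wL2 0 (iteratedDeriv i u) ^ 2) +
      ∑ j ∈ Finset.range (m / 2), wL2 ((j : ℝ) + 1) (iteratedDeriv (m / 2 + j + 1) u) ^ 2
  else
    (∑ i ∈ Finset.range (m / 2 + 1), wL2 0 (iteratedDeriv i u) ^ 2) +
      ∑ j ∈ Finset.range (m / 2 + 1), wL2 ((j : ℝ) + 1 / 2) (iteratedDeriv (m / 2 + j + 1) u) ^ 2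

/-- The weighted Sobolev norm `X^m`, valued in `[0,∞]`. -/
def Xnorm {E : Type*} [NormedAddCommGroup E] [NormedSpace ℝ E] (m : ℕ) (u : ℝ → E) : ℝ≥0∞ :=
  XnormSq m u ^ ((1:ℝ) / 2)

/-- The square of the companion weighted Sobolev norm `Y^m` on `(0,1)`:
for `m = 2k`, `‖u‖_{Y^m}² = Σ_{i=0}^{k-1} ‖∂^i u‖² + Σ_{j=1}^{k+1} ‖s^{j-1/2} ∂^{k+j-1} u‖²`;
for `m = 2k+1`, `‖u‖_{Y^m}² = Σ_{i=0}^{k} ‖∂^i u‖² + Σ_{j=1}^{k+1} ‖s^{j} ∂^{k+j} u‖²`. -/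
def YnormSq {E : Type*} [NormedAddCommGroup E] [NormedSpace ℝ E] (m : ℕ) (u : ℝ → E) : ℝ≥0∞ :=
  if m % 2 = 0 then
    (∑ i ∈ Finset.range (m / 2), wL2 0 (iteratedDeriv i u) ^ 2) +
      ∑ j ∈ Finset.range (m / 2 + 1), wL2 ((j : ℝ) + 1 / 2) (iteratedDeriv (m / 2 + j) u) ^ 2
  else
    (∑ i ∈ Finset.range (m / 2 + 1), wL2 0 (iteratedDeriv i u) ^ 2) +
      ∑ j ∈ Finset.range (m / 2 + 1), wL2 ((j : ℝ) + 1) (iteratedDeriv (m / 2 + j + 1) u) ^ 2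

/-- The weighted Sobolev norm `Y^m`, valued in `[0,∞]`. -/
def Ynorm {E : Type*} [NormedAddCommGroup E] [NormedSpace ℝ E] (m : ℕ) (u : ℝ → E) : ℝ≥0∞ :=
  YnormSq m u ^ ((1:ℝ) / 2)


/-- a sequence of successive derivatives on `(0,1)` -/
def DSeq (g : ℕ → ℝ → ℝ) : Prop :=
  ∀ i, ∀ s ∈ Set.Ioo (0:ℝ) 1, HasDerivAt (g i) (g (i+1) s) s

/-- uniform weighted L² bound on compact subintervals -/
def Bd (β : ℝ) (g : ℝ → ℝ) (K : ℝ) : Prop :=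
  ∀ a b, 0 < a → a ≤ b → b < 1 → ∫ s in a..b, s ^ (2 * β) * g s ^ 2 ≤ K

/-- the weight exponent -/
def wt (h : ℝ) (i : ℕ) : ℝ := max ((i:ℝ) - h) 0

lemma DSeq.cont {g : ℕ → ℝ → ℝ} (hg : DSeq g) (i : ℕ) : ContinuousOn (g i) (Set.Ioo 0 1) :=
  fun s hs => (hg i s hs).continuousAt.continuousWithinAt

lemma cont_w {g : ℝ → ℝ} (hg : ContinuousOn g (Set.Ioo 0 1)) (β : ℝ) :
    ContinuousOn (fun s => s ^ (2 * β) * g s ^ 2) (Set.Ioo 0 1) := by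
  apply ContinuousOn.mul _ (hg.pow 2)
  intro s hs
  exact (Real.continuousAt_rpow_const s _ (Or.inl hs.1.ne')).continuousWithinAt

lemma cont_cw {g : ℝ → ℝ} (hg : ContinuousOn g (Set.Ioo 0 1)) (β c : ℝ) :
    ContinuousOn (fun s => c * (s ^ (2 * β) * g s ^ 2)) (Set.Ioo 0 1) :=
  continuousOn_const.mul (cont_w hg β)

lemma icc_sub {a b : ℝ} (ha : 0 < a) (hb : b < 1) : Set.Icc a b ⊆ Set.Ioo 0 1 :=
  fun _ hx => ⟨lt_of_lt_of_le ha hx.1, lt_of_le_of_lt hx.2 hb⟩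

lemma ii {ψ : ℝ → ℝ} (hψ : ContinuousOn ψ (Set.Ioo 0 1)) {a b : ℝ} (ha : 0 < a) (hab : a ≤ b)
    (hb : b < 1) : IntervalIntegrable ψ volume a b :=
  (hψ.mono (icc_sub ha hb)).intervalIntegrable_of_Icc hab

lemma ftc_le {φ φ' ψ : ℝ → ℝ} (hφ : ∀ s ∈ Set.Ioo (0:ℝ) 1, HasDerivAt φ (φ' s) s)
    (hψ : ContinuousOn ψ (Set.Ioo 0 1)) (hle : ∀ s ∈ Set.Ioo (0:ℝ) 1, φ' s ≤ ψ s)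
    {a b : ℝ} (ha : 0 < a) (hab : a ≤ b) (hb : b < 1) :
    φ b - φ a ≤ ∫ s in a..b, ψ s := by
  have hs := icc_sub ha hb
  apply intervalIntegral.sub_le_integral_of_hasDeriv_right_of_le hab (g' := φ')
  · exact fun s h => (hφ s (hs h)).continuousAt.continuousWithinAt
  · exact fun s h => (hφ s (hs (Set.Ioo_subset_Icc_self h))).hasDerivWithinAt
  · exact (hψ.mono hs).integrableOn_Icc
  · exact fun s h => hle s (hs (Set.Ioo_subset_Icc_self h))

/-- comparison of integrals of continuous functions -/
lemma int_mono {ψ χ : ℝ → ℝ} (hψ : ContinuousOn ψ (Set.Ioo 0 1)) (hχ : ContinuousOn χ (Set.Ioo 0 1))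
    {a b : ℝ} (ha : 0 < a) (hab : a ≤ b) (hb : b < 1)
    (hle : ∀ s ∈ Set.Icc a b, ψ s ≤ χ s) :
    ∫ s in a..b, ψ s ≤ ∫ s in a..b, χ s :=
  intervalIntegral.integral_mono_on hab (ii hψ ha hab hb) (ii hχ ha hab hb) hle

lemma avg {φ φ' ψ χ : ℝ → ℝ} {K D : ℝ} (hφ : ∀ s ∈ Set.Ioo (0:ℝ) 1, HasDerivAt φ (φ' s) s)
    (hψ : ContinuousOn ψ (Set.Ioo 0 1)) (hχ : ContinuousOn χ (Set.Ioo 0 1))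
    (hle : ∀ s ∈ Set.Ioo (0:ℝ) 1, |φ' s| ≤ ψ s) (hle2 : ∀ s ∈ Set.Ioo (0:ℝ) 1, φ s ≤ χ s)
    (hK : ∀ a b, 0 < a → a ≤ b → b < 1 → ∫ s in a..b, χ s ≤ K)
    (hD : ∀ a b, 0 < a → a ≤ b → b < 1 → ∫ s in a..b, ψ s ≤ D) :
    ∀ x ∈ Set.Ioo (0:ℝ) 1, φ x ≤ 2 * K + D := by
  intro x hx
  have h1 : ∀ y ∈ Set.Ioo (0:ℝ) 1, φ x - D ≤ φ y := by
    intro y hy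
    rcases le_total x y with h | h
    · have := ftc_le (φ := fun s => - φ s) (φ' := fun s => - φ' s) (fun s hs => (hφ s hs).neg) hψ
        (fun s hs => (neg_le_abs _).trans (hle s hs)) hx.1 h hy.2
      have := hD x y hx.1 h hy.2
      linarith
    · have := ftc_le hφ hψ (fun s hs => (le_abs_self _).trans (hle s hs)) hy.1 h hx.2
      have := hD y x hy.1 h hx.2
      linarith
  have h2 := int_mono (ψ := fun _ => φ x - D) (χ := χ) continuousOn_const hχ
    (a := 1/4) (b := 3/4) (by norm_num) (by norm_num) (by norm_num) (fun s hs =>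
      have hs' := icc_sub (by norm_num) (by norm_num) hs
      (h1 s hs').trans (hle2 s hs'))
  have h3 := hK (1/4) (3/4) (by norm_num) (by norm_num) (by norm_num)
  rw [intervalIntegral.integral_const, smul_eq_mul] at h2
  linarith

lemma Bd.mono {β β' : ℝ} {g : ℝ → ℝ} {K : ℝ} (hg : ContinuousOn g (Set.Ioo 0 1))
    (h : Bd β g K) (hβ : β ≤ β') : Bd β' g K := by
  intro a b ha hab hb
  refine le_trans (int_mono (cont_w hg _) (cont_w hg _) ha hab hb ?_) (h a b ha hab hb)
  intro s hs
  have hs' := icc_sub ha hb hs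
  exact mul_le_mul_of_nonneg_right
    (Real.rpow_le_rpow_of_exponent_ge hs'.1 hs'.2.le (by linarith)) (sq_nonneg _)

lemma Bd.monoK {β : ℝ} {g : ℝ → ℝ} {K K' : ℝ} 
    (h : Bd β g K) (hβ : K ≤ K') : Bd β g K' := 
  fun a b ha hab hb => (h a b ha hab hb).trans hβ

/-- pointwise combination -/
lemma Bd.comb2 {β β1 β2 : ℝ} {g g1 g2 : ℝ → ℝ} {K1 K2 c1 c2 : ℝ} 
    (hg : ContinuousOn g (Set.Ioo 0 1))
    (hg1 : ContinuousOn g1 (Set.Ioo 0 1)) (hg2 : ContinuousOn g2 (Set.Ioo 0 1))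
    (hc1 : 0 ≤ c1) (hc2 : 0 ≤ c2)
    (h1 : Bd β1 g1 K1) (h2 : Bd β2 g2 K2)
    (hle : ∀ s ∈ Set.Ioo (0:ℝ) 1, s ^ (2*β) * g s ^ 2 ≤
      c1 * (s ^ (2*β1) * g1 s ^ 2) + c2 * (s ^ (2*β2) * g2 s ^ 2)) :
    Bd β g (c1 * K1 + c2 * K2) := by
  intro a b ha hab hb
  have e1 := h1 a b ha hab hb
  have e2 := h2 a b ha hab hb
  refine le_trans (int_mono (cont_w hg _) (χ := fun s => c1 * (s ^ (2*β1) * g1 s ^ 2) + c2 * (s ^ (2*β2) * g2 s ^ 2)) ?_ ha hab hb fun s hs => hle s (icc_sub ha hb hs)) ?_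
  · exact (cont_cw hg1 _ _).add (cont_cw hg2 _ _)
  · rw [intervalIntegral.integral_add, intervalIntegral.integral_const_mul, intervalIntegral.integral_const_mul]
    · exact add_le_add (mul_le_mul_of_nonneg_left e1 hc1) (mul_le_mul_of_nonneg_left e2 hc2)
    · exact (ii (cont_w hg1 _) ha hab hb).const_mul c1
    · exact (ii (cont_w hg2 _) ha hab hb).const_mul c2

lemma rpow_two_add {s : ℝ} (hs : 0 < s) (β : ℝ) : s ^ (2 * (β + 1)) = s ^ (2*β) * s ^ 2 := by
  rw [← Real.rpow_natCast s 2, ← Real.rpow_add hs]; congr 1; push_cast; ring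

/-- weighted sup bound -/
lemma sup_w {g g' : ℝ → ℝ} {a K K' : ℝ} (ha : 0 ≤ a)
    (hd : ∀ s ∈ Set.Ioo (0:ℝ) 1, HasDerivAt g (g' s) s) (hg' : ContinuousOn g' (Set.Ioo 0 1))
    (h : Bd a g K) (h' : Bd (a+1) g' K') :
    ∀ s ∈ Set.Ioo (0:ℝ) 1, s ^ (2 * a) * s * g s ^ 2 ≤ (2 * a + 4) * K + K' := by
  have hg : ContinuousOn g (Set.Ioo 0 1) := fun s hs => (hd s hs).continuousAt.continuousWithinAt
  have key := avg (φ := fun s => s ^ (2*a+1) * g s ^ 2)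
    (φ' := fun s => (2*a+1) * s ^ (2*a) * g s ^ 2 + s ^ (2*a+1) * (2 * g s * g' s))
    (ψ := fun s => (2*a+2) * (s ^ (2*a) * g s ^ 2) + s ^ (2*(a+1)) * g' s ^ 2)
    (χ := fun s => s ^ (2*a) * g s ^ 2) (K := K) (D := (2*a+2) * K + K') ?_ ?_ (cont_w hg _) ?_ ?_ h ?_
  · intro s hs
    have := key s hs
    simp only [Real.rpow_add_one hs.1.ne'] at this
    linarith
  · intro s hs
    have h1 := Real.hasDerivAt_rpow_const (x := s) (p := 2*a+1) (Or.inl hs.1.ne')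
    have h2 := h1.fun_mul ((hd s hs).fun_pow 2)
    refine h2.congr_deriv ?_
    simp
  · exact (cont_cw hg _ _).add (cont_w hg' _)
  · intro s hs
    rw [rpow_two_add hs.1, Real.rpow_add_one hs.1.ne']
    have hp := Real.rpow_pos_of_pos hs.1 (2*a)
    rw [abs_le]
    constructor
    · nlinarith [mul_nonneg hp.le (sq_nonneg (g s + s * g' s)), mul_nonneg hp.le (sq_nonneg (g s)), mul_nonneg ha (mul_nonneg hp.le (sq_nonneg (g s)))]
    · nlinarith [mul_nonneg hp.le (sq_nonneg (g s - s * g' s))]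
  · intro s hs
    simp only [Real.rpow_add_one hs.1.ne']
    have hp := Real.rpow_pos_of_pos hs.1 (2*a)
    nlinarith [mul_nonneg hp.le (sq_nonneg (g s)), hs.2]
  · intro x y hx hxy hy
    rw [intervalIntegral.integral_add, intervalIntegral.integral_const_mul]
    · exact add_le_add (mul_le_mul_of_nonneg_left (h x y hx hxy hy) (by linarith)) (h' x y hx hxy hy)
    · exact (ii (cont_w hg _) hx hxy hy).const_mul _
    · exact (ii (cont_w hg' _) hx hxy hy)

/-- unweighted sup bound -/
lemma sup_0 {g g' : ℝ → ℝ} {K K' : ℝ} 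
    (hd : ∀ s ∈ Set.Ioo (0:ℝ) 1, HasDerivAt g (g' s) s) (hg' : ContinuousOn g' (Set.Ioo 0 1))
    (h : Bd 0 g K) (h' : Bd 0 g' K') :
    ∀ s ∈ Set.Ioo (0:ℝ) 1, g s ^ 2 ≤ 3 * K + K' := by
  have hg : ContinuousOn g (Set.Ioo 0 1) := fun s hs => (hd s hs).continuousAt.continuousWithinAt
  have key := avg (φ := fun s => g s ^ 2)
    (φ' := fun s => (2 * g s * g' s))
    (ψ := fun s => s ^ (2*(0:ℝ)) * g s ^ 2 + s ^ (2*(0:ℝ)) * g' s ^ 2)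
    (χ := fun s => s ^ (2*(0:ℝ)) * g s ^ 2) (K := K) (D := K + K') ?_ ?_ (cont_w hg _) ?_ ?_ h ?_
  · intro s hs
    have := key s hs
    linarith
  · intro s hs
    refine ((hd s hs).fun_pow 2).congr_deriv ?_
    simp
  · exact ((cont_w hg _)).add (cont_w hg' _)
  · intro s hs
    simp only [mul_zero, Real.rpow_zero, one_mul]
    rw [abs_le]
    constructor
    · nlinarith [sq_nonneg (g s + g' s)]
    · nlinarith [sq_nonneg (g s - g' s)]
  · intro s hs
    simp
  · intro x y hx hxy hy
    rw [intervalIntegral.integral_add]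
    · exact add_le_add (h x y hx hxy hy) (h' x y hx hxy hy)
    · exact (ii (cont_w hg _) hx hxy hy)
    · exact (ii (cont_w hg' _) hx hxy hy)

/-- Cauchy-Schwarz -/
lemma cs {y k : ℝ → ℝ} {L a b : ℝ} (hd : ∀ s ∈ Set.Ioo (0:ℝ) 1, HasDerivAt y (k s) s)
    (hk : ContinuousOn k (Set.Ioo 0 1)) (ha : 0 < a) (hab : a ≤ b) (hb : b < 1)
    (hL : ∫ s in a..b, k s ^ 2 ≤ L) : (y b - y a) ^ 2 ≤ (b - a) * L := by
  rcases hab.eq_or_lt with rfl | hlt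
  · simp
  have hba : 0 < b - a := sub_pos.2 hlt
  set l := (y b - y a) / (b - a) with hl
  have h := ftc_le (φ := fun s => 2 * l * y s) (φ' := fun s => 2 * l * k s)
    (ψ := fun s => l^2 + k s ^ 2) (fun s hs => (hd s hs).const_mul _)
    (continuousOn_const.add (hk.pow 2)) (fun s _ => by nlinarith [sq_nonneg (l - k s)]) ha hab hb
  rw [intervalIntegral.integral_add (by simp) (ii (hk.fun_pow 2) ha hab hb),
    intervalIntegral.integral_const, smul_eq_mul] at h
  have e : y b - y a = l * (b - a) := by rw [hl]; field_simp
  have : 2 * l * (l * (b-a)) ≤ (b-a) * l^2 + L := by rw [← e]; linarith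
  rw [e]
  nlinarith

/-- Hardy inequality -/
lemma hardy1 {z z' g : ℝ → ℝ} {i : ℕ} {β K : ℝ} (hβ : β ≤ i)
    (hd : ∀ s ∈ Set.Ioo (0:ℝ) 1, HasDerivAt z (z' s) s)
    (hg : ContinuousOn g (Set.Ioo 0 1))
    (heq : ∀ s ∈ Set.Ioo (0:ℝ) 1, s * z' s + (i+1) * z s = g s)
    (hlim : Filter.Tendsto (fun s => s ^ (i+1) * z s) (nhdsWithin 0 (Set.Ioi 0)) (nhds 0))
    (h : Bd β g K) : Bd β z (6 * K) := by
  have hz : ContinuousOn z (Set.Ioo 0 1) := fun s hs => (hd s hs).continuousAt.continuousWithinAt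
  have hy : ∀ s ∈ Set.Ioo (0:ℝ) 1, HasDerivAt (fun s => s ^ (i+1) * z s) (s ^ i * g s) s := by
    intro s hs
    have := (hasDerivAt_pow (i+1) s).fun_mul (hd s hs)
    refine this.congr_deriv ?_
    rw [← heq s hs]
    simp
    ring
  have hb : ∀ a ∈ Set.Ioo (0:ℝ) 1, a ^ (2*β) * a * z a ^ 2 ≤ K := by
    intro a ha
    have hp := Real.rpow_pos_of_pos ha.1 (2*β)
    have hp2 := Real.rpow_pos_of_pos ha.1 (2*(i-β))
    have hpp : a ^ (2*(i-β)) * a ^ (2*β) = a^(2*i) := by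
      rw [← Real.rpow_natCast a (2*i), ← Real.rpow_add ha.1]; congr 1; push_cast; ring
    have hK : 0 ≤ K := by simpa using h a a ha.1 le_rfl ha.2
    have h1 : ∀ e ∈ Set.Ioo (0:ℝ) a, (a ^ (i+1) * z a - e ^ (i+1) * z e) ^ 2 ≤ a * (a ^ (2*(i-β)) * K) := by
      intro e he
      refine (cs hy (L := a ^ (2*(i-β)) * K) ((continuousOn_id.pow i).mul hg) he.1 he.2.le ha.2 ?_).trans ?_
      · have := int_mono (ψ := fun s => (s ^ i * g s)^2) (χ := fun s => a ^ (2*(i-β)) * (s ^ (2*β) * g s ^ 2))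
          (((continuousOn_id.pow i).mul hg).pow 2) (cont_cw hg _ _) he.1 he.2.le ha.2 ?_
        · refine this.trans ?_
          rw [intervalIntegral.integral_const_mul]
          exact mul_le_mul_of_nonneg_left (h e a he.1 he.2.le ha.2) hp2.le
        · intro s hs
          have hs0 : 0 < s := he.1.trans_le hs.1
          have : s ^ (2*(i-β)) * s ^ (2*β) = s^(2*i) := by
            rw [← Real.rpow_natCast s (2*i), ← Real.rpow_add hs0]; congr 1; push_cast; ring
          calc (s ^ i * g s)^2 = s ^ (2*(i-β)) * (s ^ (2*β) * g s ^ 2) := by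
                rw [← mul_assoc, this]; ring
            _ ≤ _ := by
                apply mul_le_mul_of_nonneg_right
                · exact Real.rpow_le_rpow hs0.le hs.2 (by linarith)
                · positivity
      · apply mul_le_mul_of_nonneg_right _ (by positivity)
        linarith [he.1]
    have h2 : (a ^ (i+1) * z a - 0) ^ 2 ≤ a * (a ^ (2*(i-β)) * K) := by
      refine le_of_tendsto ((hlim.const_sub (a ^ (i+1) * z a)).pow 2) ?_
      filter_upwards [Ioo_mem_nhdsGT ha.1] with e he using h1 e he
    have h3 : a ^ (2*i+1) * (a ^ (2*β) * a * z a ^ 2) ≤ a ^ (2*i+1) * K := by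
      calc a ^ (2*i+1) * (a ^ (2*β) * a * z a ^ 2) = a ^ (2*β) * (a ^ (i+1) * z a - 0) ^ 2 := by ring
        _ ≤ a ^ (2*β) * (a * (a ^ (2*(i-β)) * K)) := mul_le_mul_of_nonneg_left h2 hp.le
        _ = a * (a ^ (2*(i-β)) * a ^ (2*β)) * K := by ring
        _ = _ := by rw [hpp]; ring
    exact le_of_mul_le_mul_left h3 (pow_pos ha.1 _)
  intro a b ha hab hb1
  have haI : a ∈ Set.Ioo (0:ℝ) 1 := ⟨ha, hab.trans_lt hb1⟩
  have hbI : b ∈ Set.Ioo (0:ℝ) 1 := ⟨ha.trans_le hab, hb1⟩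
  have e := ftc_le (φ := fun s => s ^ (2*β+1) * z s ^ 2)
    (φ' := fun s => (2*β+1) * s ^ (2*β) * z s ^ 2 + s ^ (2*β+1) * (2 * z s * z' s))
    (ψ := fun s => 2 * (s ^ (2*β) * g s ^ 2) - (1/2) * (s ^ (2*β) * z s ^ 2)) ?_ ?_ ?_ ha hab hb1
  · rw [intervalIntegral.integral_sub ((ii (cont_w hg _) ha hab hb1).const_mul _) ((ii (cont_w hz _) ha hab hb1).const_mul _),
      intervalIntegral.integral_const_mul, intervalIntegral.integral_const_mul] at e
    simp only [Real.rpow_add_one ha.ne', Real.rpow_add_one hbI.1.ne'] at e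
    have h1 := h a b ha hab hb1
    have h2 := hb a haI
    have h3 : 0 ≤ b ^ (2*β) * b * z b ^ 2 := by have := hbI.1; positivity
    linarith
  · intro s hs
    have h1 := Real.hasDerivAt_rpow_const (x := s) (p := 2*β+1) (Or.inl hs.1.ne')
    have h2 := h1.fun_mul ((hd s hs).fun_pow 2)
    refine h2.congr_deriv ?_
    simp
  · exact (cont_cw hg _ _).sub (cont_cw hz _ _)
  · intro s hs
    rw [Real.rpow_add_one hs.1.ne']
    have hp := Real.rpow_pos_of_pos hs.1 (2*β)
    have : (2*β+1) * s ^ (2*β) * z s ^ 2 + s ^ (2*β) * s * (2 * z s * z' s)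
      = s ^ (2*β) * ((2*β+1) * z s ^ 2 + 2 * z s * (g s - (i+1) * z s)) := by
      rw [← heq s hs]; ring
    rw [this]
    have h2 : (2*β+1) * z s ^ 2 + 2 * z s * (g s - (i+1) * z s) ≤ 2 * g s ^ 2 - 1/2 * z s^2 := by
      nlinarith [sq_nonneg (2 * g s - z s), mul_nonneg (sub_nonneg.2 hβ) (sq_nonneg (z s))]
    calc _ ≤ s ^ (2*β) * (2 * g s ^ 2 - 1/2 * z s^2) := mul_le_mul_of_nonneg_left h2 hp.le
      _ = _ := by ring

lemma wt_nonneg (h : ℝ) (i : ℕ) : 0 ≤ wt h i := le_max_right _ _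
lemma wt_le {h : ℝ} (hh : 0 ≤ h) (i : ℕ) : wt h i ≤ i :=
  max_le (by linarith) (Nat.cast_nonneg _)
lemma wt_succ_le (h : ℝ) (i : ℕ) : wt h (i+1) ≤ wt h i + 1 := by
  unfold wt
  push_cast
  apply max_le
  · linarith [le_max_left ((i:ℝ) - h) 0]
  · linarith [le_max_right ((i:ℝ) - h) 0]

lemma rel_all {w f : ℕ → ℝ → ℝ} (hw : DSeq w) (hf : DSeq f)
    (h0 : ∀ s ∈ Set.Ioo (0:ℝ) 1, HasDerivAt (fun s => s * w 0 s) (f 0 s) s) (i : ℕ) :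
    ∀ s ∈ Set.Ioo (0:ℝ) 1, s * w (i+1) s + (i+1) * w i s = f i s := by
  induction i with
  | zero =>
    intro s hs
    have := ((hasDerivAt_id s).fun_mul (hw 0 s hs)).unique (h0 s hs)
    simp only [id] at this
    rw [← this]; push_cast; ring
  | succ i ih =>
    intro s hs
    have h1 := (((hasDerivAt_id s).fun_mul (hw (i+1) s hs))).fun_add ((hw i s hs).const_mul ((i:ℝ)+1))
    have h2 : HasDerivAt (f i) _ s := h1.congr_of_eventuallyEq (by
      filter_upwards [isOpen_Ioo.mem_nhds hs] with t ht using (ih t ht).symm)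
    have := h2.unique (hf i s hs)
    rw [← this]; push_cast; simp only [id]; ring

lemma hardy_seq {w f : ℕ → ℝ → ℝ} {h K : ℝ} {J : ℕ} (hh : 0 ≤ h) (hw : DSeq w) (hf : DSeq f)
    (hrel : ∀ i : ℕ, ∀ s ∈ Set.Ioo (0:ℝ) 1, s * w (i+1) s + (i+1) * w i s = f i s)
    (hlim : Filter.Tendsto (fun s => s * w 0 s) (nhdsWithin 0 (Set.Ioi 0)) (nhds 0))
    (hB : ∀ i ≤ J, Bd (wt h i) (f i) K) (i : ℕ) (hi : i ≤ J) : Bd (wt h i) (w i) (6 * K) := by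
  have hl : ∀ i ≤ J, Filter.Tendsto (fun s => s ^ (i+1) * w i s) (nhdsWithin 0 (Set.Ioi 0)) (nhds 0) := by
    intro i
    induction i with
    | zero => intro _; simpa using hlim
    | succ i ih =>
      intro hi
      have h1 := ih (by omega)
      have hb := sup_w (Nat.cast_nonneg i) (hf i) (hf.cont (i+1))
        ((hB i (by omega)).mono (hf.cont _) (wt_le hh i))
        ((hB (i+1) hi).mono (hf.cont _) (by simpa using wt_le hh (i+1)))
      set D := (2 * (i:ℝ) + 4) * K + K
      have hD : 0 ≤ D := le_trans (by positivity) (hb (1/2) (by norm_num))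
      have h2 : Filter.Tendsto (fun s => s ^ (i+1) * f i s) (nhdsWithin 0 (Set.Ioi 0)) (nhds 0) := by
        have h3 : Filter.Tendsto (fun s : ℝ => √(s * D)) (nhdsWithin 0 (Set.Ioi 0)) (nhds 0) := by
          have : Continuous (fun s : ℝ => √(s * D)) := by fun_prop
          have := this.tendsto 0
          simp only [zero_mul, Real.sqrt_zero] at this
          exact this.mono_left nhdsWithin_le_nhds
        apply squeeze_zero_norm' _ h3
        filter_upwards [Ioo_mem_nhdsGT (zero_lt_one' ℝ)] with s hs
        rw [Real.norm_eq_abs]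
        apply Real.abs_le_sqrt
        have h4 := hb s hs
        have h5 : s ^ (2 * (i:ℝ)) = s ^ (2 * i) := by
          rw [← Real.rpow_natCast]; push_cast; rfl
        rw [h5] at h4
        calc (s ^ (i+1) * f i s) ^ 2 = s * (s ^ (2*i) * s * f i s ^ 2) := by ring
          _ ≤ s * D := mul_le_mul_of_nonneg_left h4 hs.1.le
      have h3 := h2.sub (h1.const_mul ((i:ℝ)+1))
      simp only [mul_zero, sub_zero] at h3
      refine h3.congr' ?_
      filter_upwards [Ioo_mem_nhdsGT (zero_lt_one' ℝ)] with s hs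
      rw [← hrel i s hs]; ring
  exact hardy1 (wt_le hh i) (hw i) (hf.cont i) (hrel i) (hl i hi) (hB i hi)

lemma hardy_seq' {w f : ℕ → ℝ → ℝ} {h K : ℝ} {J : ℕ} (hh : 0 ≤ h) (hhJ : h ≤ J) (hw : DSeq w) (hf : DSeq f)
    (h0 : ∀ s ∈ Set.Ioo (0:ℝ) 1, HasDerivAt (fun s => s * w 0 s) (f 0 s) s)
    (hlim : Filter.Tendsto (fun s => s * w 0 s) (nhdsWithin 0 (Set.Ioi 0)) (nhds 0))
    (hB : ∀ i ≤ J, Bd (wt h i) (f i) K) (i : ℕ) (hi : i ≤ J + 1) :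
    Bd (wt h i) (w i) ((6 + 12 * ((J:ℝ)+1)^2) * K) := by
  have hrel := rel_all hw hf h0
  have key := hardy_seq hh hw hf hrel hlim hB
  have hK : 0 ≤ K := by simpa using hB 0 (Nat.zero_le _) (1/2) (1/2) (by norm_num) le_rfl (by norm_num)
  rcases Nat.lt_or_ge i (J+1) with h1 | h1
  · refine (key i (by omega)).monoK ?_
    nlinarith [mul_nonneg (sq_nonneg ((J:ℝ)+1)) hK]
  · obtain rfl : i = J + 1 := by omega
    have hwt : wt h (J+1) = wt h J + 1 := by
      unfold wt; rw [max_eq_left, max_eq_left] <;> push_cast <;> linarith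
    have := Bd.comb2 (β := wt h (J+1)) (g := w (J+1)) (c1 := 2) (c2 := 2*((J:ℝ)+1)^2) (hw.cont _) (hf.cont J) (hw.cont J) (by norm_num)
      (by positivity) (hB J le_rfl) (key J le_rfl) ?_
    · exact this.monoK (by nlinarith)
    · intro s hs
      rw [hwt, rpow_two_add hs.1]
      have hp := Real.rpow_pos_of_pos hs.1 (2 * wt h J)
      have e := hrel J s hs
      have e2 : (s * w (J+1) s)^2 ≤ 2 * f J s ^2 + 2*((J:ℝ)+1)^2 * w J s ^ 2 := by
        have : s * w (J+1) s = f J s - (J+1) * w J s := by linarith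
        rw [this]; nlinarith [sq_nonneg (f J s + (J+1) * w J s)]
      calc _ = s ^ (2 * wt h J) * (s * w (J+1) s)^2 := by ring
        _ ≤ _ := mul_le_mul_of_nonneg_left e2 hp.le
        _ = _ := by ring

lemma Bd.sum {ι : Type*} {S : Finset ι} {β c : ℝ} {g : ℝ → ℝ} {G : ι → ℝ → ℝ} {K : ι → ℝ}
    (hg : ContinuousOn g (Set.Ioo 0 1)) (hG : ∀ k ∈ S, ContinuousOn (G k) (Set.Ioo 0 1))
    (hc : 0 ≤ c) (h : ∀ k ∈ S, Bd β (G k) (K k))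
    (hle : ∀ s ∈ Set.Ioo (0:ℝ) 1, g s ^ 2 ≤ c * ∑ k ∈ S, G k s ^ 2) :
    Bd β g (c * ∑ k ∈ S, K k) := by
  intro a b ha hab hb
  refine le_trans (int_mono (cont_w hg _) (χ := fun s => c * ∑ k ∈ S, s ^ (2*β) * G k s ^ 2) ?_ ha hab hb fun s hs => ?_) ?_
  · exact continuousOn_const.mul (continuousOn_finsetSum _ fun k hk => cont_w (hG k hk) _)
  · have hs' := icc_sub ha hb hs
    have hp := Real.rpow_pos_of_pos hs'.1 (2 * β)
    rw [← Finset.mul_sum]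
    calc _ ≤ s ^ (2*β) * (c * ∑ k ∈ S, G k s ^ 2) := mul_le_mul_of_nonneg_left (hle s hs') hp.le
      _ = _ := by ring
  · rw [intervalIntegral.integral_const_mul, intervalIntegral.integral_finsetSum]
    · exact mul_le_mul_of_nonneg_left (Finset.sum_le_sum fun k hk => h k hk a b ha hab hb) hc
    · exact fun k hk => ii (cont_w (hG k hk) _) ha hab hb

lemma Bd.prod {b c β P K : ℝ} {V M : ℝ → ℝ} (hV : ContinuousOn V (Set.Ioo 0 1))
    (hM : ContinuousOn M (Set.Ioo 0 1)) (h : Bd b V K) (hP : ∀ s ∈ Set.Ioo (0:ℝ) 1, s ^ (2*c) * M s ^ 2 ≤ P)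
    (hβ : b + c ≤ β) : Bd β (fun s => V s * M s) (P * K) := by
  have hP0 : 0 ≤ P := le_trans (by positivity) (hP (1/2) (by norm_num))
  refine Bd.mono (hV.mul hM) (β := b + c) ?_ hβ
  intro x y hx hxy hy
  refine le_trans (int_mono (cont_w (hV.fun_mul hM) _) (cont_cw hV b P) hx hxy hy fun s hs => ?_) ?_
  · have hs' := icc_sub hx hy hs
    have hp := Real.rpow_pos_of_pos hs'.1 (2 * b)
    rw [mul_add, Real.rpow_add hs'.1]
    calc _ = (s ^ (2*c) * M s ^ 2) * (s ^ (2*b) * V s ^ 2) := by ring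
      _ ≤ _ := mul_le_mul_of_nonneg_right (hP s hs') (by positivity)
  · rw [intervalIntegral.integral_const_mul]
    exact mul_le_mul_of_nonneg_left (h x y hx hxy hy) hP0

lemma leib {V M W : ℕ → ℝ → ℝ} (hV : DSeq V) (hM : DSeq M) (hW : DSeq W)
    (h0 : ∀ s ∈ Set.Ioo (0:ℝ) 1, V 0 s * M 0 s = W 0 s) (i : ℕ) :
    ∀ s ∈ Set.Ioo (0:ℝ) 1, W i s = ∑ l ∈ Finset.range (i+1), (i.choose l : ℝ) * (V l s * M (i-l) s) := by
  induction i with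
  | zero => intro s hs; simp [h0 s hs]
  | succ i ih =>
    intro s hs
    have h1 : HasDerivAt (fun s => ∑ l ∈ Finset.range (i+1), (i.choose l : ℝ) * (V l s * M (i-l) s))
        (∑ l ∈ Finset.range (i+1), (i.choose l : ℝ) * (V (l+1) s * M (i-l) s + V l s * M (i-l+1) s)) s := 
      HasDerivAt.fun_sum fun l _ => ((hV l s hs).fun_mul (hM (i-l) s hs)).const_mul _
    have h2 : HasDerivAt (W i) _ s := h1.congr_of_eventuallyEq (by
      filter_upwards [isOpen_Ioo.mem_nhds hs] with t ht using ih t ht)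
    rw [(hW i s hs).unique h2]
    simp only [mul_add, Finset.sum_add_distrib]
    have := Finset.sum_choose_succ_mul (fun l m => V l s * M m s) i
    rw [this, add_comm]
    congr 1
    apply Finset.sum_congr rfl
    intro l hl
    rw [Finset.mem_range] at hl
    rw [show i + 1 - l = i - l + 1 by omega]

/-- the hypotheses collected -/
structure Dat (j : ℕ) (m R : ℝ) (V M W : ℕ → ℝ → ℝ) (K : ℝ) : Prop where
  hV : DSeq V
  hM : DSeq M
  hW : DSeq W
  h0 : ∀ s ∈ Set.Ioo (0:ℝ) 1, V 0 s * M 0 s = W 0 s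
  hm : ∀ s ∈ Set.Ioo (0:ℝ) 1, m ≤ M 0 s
  bW : ∀ i ≤ j + 1, Bd (wt ((j:ℝ)/2) i) (W i) K
  bM : ∀ i ≤ max j 2 + 1, Bd (wt (((max j 2 : ℕ):ℝ)/2) i) (M i) R

lemma Dat.K0 {j : ℕ} {m R : ℝ} {V M W : ℕ → ℝ → ℝ} {K : ℝ} (d : Dat j m R V M W K) : 0 ≤ K := by
  simpa using d.bW 0 (Nat.zero_le _) (1/2) (1/2) (by norm_num) le_rfl (by norm_num)

lemma wt_zero_of {h : ℝ} {i : ℕ} (hi : (i:ℝ) ≤ h) : wt h i = 0 := max_eq_right (by linarith)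

lemma wt_mono (h : ℝ) {i k : ℕ} (hik : i ≤ k) : wt h i ≤ wt h k :=
  max_le_max (by have : (i:ℝ) ≤ k := by exact_mod_cast hik
                 linarith) le_rfl

lemma term_bound (j : ℕ) {m R : ℝ} (hm : 0 < m) (hR : 0 ≤ R) {A : ℝ} (hA : 0 ≤ A) (i l : ℕ) (hl : l < i) (hi : i ≤ j + 1) :
    ∃ D, 0 ≤ D ∧ ∀ V M W K, Dat j m R V M W K → Bd (wt ((j:ℝ)/2) l) (V l) (A * K) →
      Bd (wt ((j:ℝ)/2) i) (fun s => V l s * M (i-l) s) (D * K) := by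
  -- the generic case
  have gen : wt ((j:ℝ)/2) l + (wt (((max j 2 : ℕ):ℝ)/2) (i-l) + 1/2) ≤ wt ((j:ℝ)/2) i → i - l ≤ max j 2 →
      ∃ D, 0 ≤ D ∧ ∀ V M W K, Dat j m R V M W K → Bd (wt ((j:ℝ)/2) l) (V l) (A * K) →
      Bd (wt ((j:ℝ)/2) i) (fun s => V l s * M (i-l) s) (D * K) := by
    intro hwt hle
    refine ⟨((2 * wt (((max j 2 : ℕ):ℝ)/2) (i-l) + 4) * R + R) * A, ?_, ?_⟩
    · have := wt_nonneg (((max j 2 : ℕ):ℝ)/2) (i-l)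
      positivity
    · intro V M W K d hB
      have hs := sup_w (wt_nonneg (((max j 2 : ℕ):ℝ)/2) (i-l)) (d.hM (i-l)) (d.hM.cont _) (d.bM (i-l) (by omega))
        ((d.bM (i-l+1) (by omega)).mono (d.hM.cont _) (wt_succ_le _ _))
      rw [mul_assoc]
      refine Bd.prod (d.hV.cont _) (d.hM.cont _) hB (c := wt (((max j 2 : ℕ):ℝ)/2) (i-l) + 1/2) ?_ hwt
      intro s hs'
      have := hs s hs'
      rwa [mul_add, Real.rpow_add hs'.1, show (2:ℝ) * (1/2) = 1 by norm_num, Real.rpow_one]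
  obtain ⟨p, rfl⟩ : ∃ p, i = l + p := ⟨i - l, by omega⟩
  simp only [Nat.add_sub_cancel_left] at gen ⊢
  have hp1 : (1:ℝ) ≤ p := by exact_mod_cast (show 1 ≤ p by omega)
  by_cases hj : 2 ≤ j
  · have hJ : max j 2 = j := by omega
    rw [hJ] at gen
    have hj2 : (2:ℝ) ≤ j := by exact_mod_cast hj
    by_cases hl0 : l = 0
    · subst hl0
      refine ⟨(4 / m^2) * R, by positivity, ?_⟩
      intro V M W K d hB
      have hK := d.K0
      have b0 := d.bW 0 (by omega)
      have b1 := d.bW 1 (by omega)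
      rw [wt_zero_of (by push_cast; linarith)] at b0 b1
      have hs := sup_0 (d.hW 0) (d.hW.cont 1) b0 b1
      have bM := d.bM p (by omega)
      rw [hJ] at bM
      have := Bd.prod (d.hM.cont p) (d.hV.cont 0) bM (c := 0) (P := 4 / m^2 * K) (β := wt ((j:ℝ)/2) (0+p)) ?_ (by simp)
      · intro a b ha hab hb
        refine le_trans (le_of_eq ?_) ((this a b ha hab hb).trans (by linarith))
        congr 1; ext s; ring
      · intro s hs'
        have h1 := hs s hs'
        have h2 := d.hm s hs'
        rw [← d.h0 s hs'] at h1
        simp only [mul_zero, Real.rpow_zero, one_mul]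
        rw [div_mul_eq_mul_div, le_div_iff₀ (by positivity)]
        have : m^2 ≤ M 0 s ^ 2 := by gcongr
        nlinarith [sq_nonneg (V 0 s)]
    · have hl1 : (1:ℝ) ≤ l := by exact_mod_cast (show 1 ≤ l by omega)
      by_cases hp : 2 * p + 2 ≤ j
      · have hp' : 2 * (p:ℝ) + 2 ≤ j := by exact_mod_cast hp
        refine ⟨4 * R * A, by positivity, ?_⟩
        intro V M W K d hB
        have b0 := d.bM p (by omega)
        have b1 := d.bM (p+1) (by omega)
        rw [hJ, wt_zero_of (by push_cast; linarith)] at b0 b1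
        have hs := sup_0 (d.hM p) (d.hM.cont _) b0 b1
        rw [mul_assoc]
        refine Bd.prod (d.hV.cont _) (d.hM.cont _) hB (c := 0) ?_ ?_
        · intro s hs'
          have := hs s hs'
          simp only [mul_zero, Real.rpow_zero, one_mul]
          linarith
        · simpa using wt_mono _ (by omega)
      · have hp' : (j:ℝ) ≤ 2 * (p:ℝ) + 1 := by exact_mod_cast (show j ≤ 2 * p + 1 by omega)
        refine gen ?_ (by omega)
        have : wt ((j:ℝ)/2) (l+p) = l + p - (j:ℝ)/2 := by
          unfold wt; rw [max_eq_left] <;> push_cast <;> linarith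
        rw [this]
        unfold wt
        rcases max_cases ((l:ℝ) - j/2) 0 with ⟨h1, _⟩ | ⟨h1, _⟩ <;>
        rcases max_cases ((p:ℝ) - j/2) 0 with ⟨h2, _⟩ | ⟨h2, _⟩ <;> rw [h1, h2] <;> linarith
  · have hJ : max j 2 = 2 := by omega
    rw [hJ] at gen
    have hj2 : (j:ℝ) ≤ 1 := by exact_mod_cast (show j ≤ 1 by omega)
    refine gen ?_ (by omega)
    have hl0 : (0:ℝ) ≤ l := Nat.cast_nonneg _
    have : wt ((j:ℝ)/2) (l+p) = l + p - (j:ℝ)/2 := by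
      unfold wt; rw [max_eq_left] <;> push_cast <;> linarith
    rw [this]
    unfold wt
    push_cast
    rcases max_cases ((l:ℝ) - j/2) 0 with ⟨h1, _⟩ | ⟨h1, _⟩ <;>
    rcases max_cases ((p:ℝ) - 2/2) 0 with ⟨h2, _⟩ | ⟨h2, _⟩ <;> rw [h1, h2] <;> linarith

lemma core (j : ℕ) {m R : ℝ} (hm : 0 < m) (hR : 0 ≤ R) (i : ℕ) : i ≤ j + 1 →
    ∃ A, 0 ≤ A ∧ ∀ V M W K, Dat j m R V M W K → Bd (wt ((j:ℝ)/2) i) (V i) (A * K) := by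
  induction i using Nat.strong_induction_on with
  | _ i ih =>
  intro hi
  have ht : ∀ l, ∃ D, 0 ≤ D ∧ (l < i → ∀ V M W K, Dat j m R V M W K →
      Bd (wt ((j:ℝ)/2) i) (fun s => V l s * M (i-l) s) (D * K)) := by
    intro l
    by_cases hl : l < i
    · obtain ⟨A, hA, h⟩ := ih l hl (by omega)
      obtain ⟨D, hD, h'⟩ := term_bound j hm hR hA i l hl hi
      exact ⟨D, hD, fun _ V M W K d => h' V M W K d (h V M W K d)⟩
    · exact ⟨0, le_rfl, fun h => absurd h hl⟩
  choose D hD hDb using ht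
  refine ⟨(1/m)^2 * 2 * (1 + (∑ l ∈ Finset.range i, (i.choose l : ℝ)^2) * ∑ l ∈ Finset.range i, D l), ?_, ?_⟩
  · have : 0 ≤ ∑ l ∈ Finset.range i, D l := Finset.sum_nonneg fun l _ => hD l
    positivity
  intro V M W K d
  set c := ∑ l ∈ Finset.range i, (i.choose l : ℝ)^2 with hc
  have hc0 : 0 ≤ c := by positivity
  have hcg : ∀ l ∈ Finset.range i, ContinuousOn (fun s => V l s * M (i-l) s) (Set.Ioo 0 1) :=
    fun l _ => (d.hV.cont _).mul (d.hM.cont _)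
  have hS : Bd (wt ((j:ℝ)/2) i) (fun s => ∑ l ∈ Finset.range i, (i.choose l : ℝ) * (V l s * M (i-l) s))
      (c * ∑ l ∈ Finset.range i, D l * K) := by
    refine Bd.sum (G := fun l s => V l s * M (i-l) s) ?_ hcg hc0 (fun l hl => hDb l (Finset.mem_range.1 hl) V M W K d) ?_
    · exact continuousOn_finsetSum _ fun l hl => continuousOn_const.mul (hcg l hl)
    · intro s hs
      exact Finset.sum_mul_sq_le_sq_mul_sq _ _ _
  have := Bd.comb2 (β := wt ((j:ℝ)/2) i) (g := V i) (g2 := fun s => ∑ l ∈ Finset.range i, (i.choose l : ℝ) * (V l s * M (i-l) s)) (c1 := (1/m)^2*2) (c2 := (1/m)^2*2) (d.hV.cont i) (d.hW.cont i)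
    (continuousOn_finsetSum _ fun l hl => continuousOn_const.mul (hcg l hl)) (by positivity) (by positivity)
    (d.bW i hi) hS ?_
  · rw [← Finset.sum_mul] at this
    exact this.monoK (le_of_eq (by ring))
  · intro s hs
    have hp := Real.rpow_pos_of_pos hs.1 (2 * wt ((j:ℝ)/2) i)
    have e := leib d.hV d.hM d.hW d.h0 i s hs
    rw [Finset.sum_range_succ] at e
    set T := ∑ l ∈ Finset.range i, (i.choose l : ℝ) * (V l s * M (i-l) s)
    simp only [Nat.choose_self, Nat.cast_one, one_mul, Nat.sub_self] at e
    have h2 := d.hm s hs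
    have h3 : V i s ^ 2 ≤ (1/m)^2*2 * (W i s ^ 2 + T ^2) := by
      rw [one_div, inv_pow, mul_assoc, ← div_eq_inv_mul, le_div_iff₀ (by positivity)]
      have : m^2 ≤ M 0 s ^ 2 := by gcongr
      have h4 : (V i s * M 0 s)^2 ≤ 2 * (W i s ^ 2 + T ^2) := by
        rw [show V i s * M 0 s = W i s - T by linarith]; nlinarith [sq_nonneg (W i s + T)]
      nlinarith [sq_nonneg (V i s)]
    calc _ ≤ s ^ (2 * wt ((j:ℝ)/2) i) * ((1/m)^2*2 * (W i s ^ 2 + T ^2)) := mul_le_mul_of_nonneg_left h3 hp.le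
      _ = _ := by ring

lemma wL2_sq (α : ℝ) (v : ℝ → ℝ) : wL2 α v ^ 2 =
    ∫⁻ s in Set.Ioo (0:ℝ) 1, ENNReal.ofReal (s ^ (2 * α) * v s ^ 2) := by
  unfold wL2
  rw [← ENNReal.rpow_natCast, ← ENNReal.rpow_mul]
  norm_num

lemma w_nonneg (α : ℝ) (v : ℝ → ℝ) {s : ℝ} (hs : 0 < s) : 0 ≤ s ^ (2 * α) * v s ^ 2 := by positivity

lemma lint_eq {α : ℝ} {v : ℝ → ℝ} (hv : ContinuousOn v (Set.Ioo 0 1)) {a b : ℝ} (ha : 0 < a)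
    (hab : a ≤ b) (hb : b < 1) : ENNReal.ofReal (∫ s in a..b, s ^ (2 * α) * v s ^ 2) =
      ∫⁻ s in Set.Ioc a b, ENNReal.ofReal (s ^ (2 * α) * v s ^ 2) := by
  rw [intervalIntegral.integral_of_le hab, ofReal_integral_eq_lintegral_ofReal]
  · exact (ii (cont_w hv α) ha hab hb).1
  · filter_upwards [ae_restrict_mem measurableSet_Ioc] with s hs
    exact w_nonneg α v (ha.trans hs.1)

lemma bd_of_wL2 {α K : ℝ} {v : ℝ → ℝ} (hv : ContinuousOn v (Set.Ioo 0 1)) (hK : 0 ≤ K)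
    (h : wL2 α v ^ 2 ≤ ENNReal.ofReal K) : Bd α v K := by
  intro a b ha hab hb
  rw [← ENNReal.ofReal_le_ofReal_iff hK, lint_eq hv ha hab hb]
  rw [wL2_sq] at h
  exact (lintegral_mono_set (show Set.Ioc a b ⊆ Set.Ioo 0 1 from fun s hs => ⟨ha.trans hs.1, hs.2.trans_lt hb⟩)).trans h

lemma wL2_of_bd {α K : ℝ} {v : ℝ → ℝ} (hv : ContinuousOn v (Set.Ioo 0 1)) 
    (h : Bd α v K) : wL2 α v ^ 2 ≤ ENNReal.ofReal K := by
  rw [wL2_sq]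
  have ht : Filter.Tendsto (fun n : ℕ => 1 / ((n:ℝ) + 2)) Filter.atTop (nhds 0) := by
    have := (tendsto_one_div_add_atTop_nhds_zero_nat (𝕜 := ℝ)).comp (Filter.tendsto_add_atTop_nat 1)
    refine this.congr fun n => ?_
    simp only [Function.comp]; push_cast; ring
  have ht' : Filter.Tendsto (fun n : ℕ => 1 - 1 / ((n:ℝ) + 2)) Filter.atTop (nhds 1) := by
    simpa using ht.const_sub 1
  have hc := aecover_Ioo_of_Ioc (μ := volume) ht ht'
  have hm : AEMeasurable (fun s => ENNReal.ofReal (s ^ (2 * α) * v s ^ 2)) (volume.restrict (Set.Ioo (0:ℝ) 1)) :=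
    ((cont_w hv α).aemeasurable measurableSet_Ioo).ennreal_ofReal
  refine le_of_tendsto (hc.lintegral_tendsto_of_countably_generated hm) (Filter.Eventually.of_forall fun n => ?_)
  have hn : (0:ℝ) < 1 / ((n:ℝ)+2) := by positivity
  have hn2 : 1 / ((n:ℝ)+2) ≤ 1/2 := by
    apply one_div_le_one_div_of_le (by norm_num); have : (0:ℝ) ≤ n := Nat.cast_nonneg n
    linarith
  rw [Measure.restrict_restrict measurableSet_Ioc]
  refine (lintegral_mono_set Set.inter_subset_left).trans ?_
  rw [← lint_eq hv hn (by linarith) (by linarith)]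
  exact ENNReal.ofReal_le_ofReal (h _ _ hn (by linarith) (by linarith))

lemma XnormSq_eq (m : ℕ) (u : ℝ → ℝ) :
    XnormSq m u = ∑ i ∈ Finset.range (m+1), wL2 (wt ((m:ℝ)/2) i) (iteratedDeriv i u) ^ 2 := by
  unfold XnormSq
  split_ifs with h
  · obtain ⟨k, rfl⟩ : ∃ k, m = 2 * k := ⟨m / 2, by omega⟩
    rw [show 2 * k / 2 = k by omega, show 2 * k + 1 = (k + 1) + k by ring, Finset.sum_range_add _ (k+1) k]
    congr 1
    · apply Finset.sum_congr rfl
      intro i hi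
      rw [wt_zero_of]
      have : (i:ℝ) ≤ k := by exact_mod_cast Nat.lt_succ_iff.1 (Finset.mem_range.1 hi)
      push_cast; linarith
    · apply Finset.sum_congr rfl
      intro i hi
      have : wt (((2 * k : ℕ):ℝ)/2) (k + 1 + i) = i + 1 := by
        unfold wt
        have : (0:ℝ) ≤ i := Nat.cast_nonneg _
        rw [max_eq_left] <;> push_cast <;> linarith
      rw [this, show k + i + 1 = k + 1 + i by ring]
  · obtain ⟨k, rfl⟩ : ∃ k, m = 2 * k + 1 := ⟨m / 2, by omega⟩
    rw [show (2 * k + 1) / 2 = k by omega, show 2 * k + 1 + 1 = (k + 1) + (k + 1) by ring, Finset.sum_range_add _ (k+1) (k+1)]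
    congr 1
    · apply Finset.sum_congr rfl
      intro i hi
      rw [wt_zero_of]
      have : (i:ℝ) ≤ k := by exact_mod_cast Nat.lt_succ_iff.1 (Finset.mem_range.1 hi)
      push_cast; linarith
    · apply Finset.sum_congr rfl
      intro i hi
      have : wt (((2 * k + 1 : ℕ):ℝ)/2) (k + 1 + i) = i + 1/2 := by
        unfold wt
        have : (0:ℝ) ≤ i := Nat.cast_nonneg _
        rw [max_eq_left] <;> push_cast <;> linarith
      rw [this, show k + i + 1 = k + 1 + i by ring]

lemma Xnorm_sq (m : ℕ) (u : ℝ → ℝ) : Xnorm m u ^ 2 = XnormSq m u := by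
  unfold Xnorm
  rw [← ENNReal.rpow_natCast, ← ENNReal.rpow_mul]
  norm_num

lemma bd_of_Xnorm {m : ℕ} {u : ℝ → ℝ} {N : ℝ} (hN : 0 ≤ N) (h : Xnorm m u ≤ ENNReal.ofReal N)
    (i : ℕ) (hi : i ≤ m) (hc : ContinuousOn (iteratedDeriv i u) (Set.Ioo 0 1)) :
    Bd (wt ((m:ℝ)/2) i) (iteratedDeriv i u) (N^2) := by
  apply bd_of_wL2 hc (by positivity)
  rw [ENNReal.ofReal_pow hN]
  calc _ ≤ XnormSq m u := by
        rw [XnormSq_eq]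
        exact Finset.single_le_sum (f := fun i => wL2 (wt ((m:ℝ)/2) i) (iteratedDeriv i u) ^ 2)
          (fun _ _ => zero_le) (Finset.mem_range.2 (by omega))
    _ = Xnorm m u ^ 2 := (Xnorm_sq m u).symm
    _ ≤ _ := by gcongr

lemma dseq_of {g : ℝ → ℝ} (hg : ContDiffOn ℝ (⊤ : ℕ∞) g (Set.Ioo 0 1)) :
    DSeq (fun i => iteratedDeriv i g) := by
  intro i s hs
  have h1 : ContDiffAt ℝ (⊤ : ℕ∞) g s := hg.contDiffAt (isOpen_Ioo.mem_nhds hs)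
  have h2 : DifferentiableAt ℝ (iteratedDeriv i g) s := by
    have hd := hg.differentiableOn_iteratedDerivWithin (m := i) (by exact_mod_cast ENat.natCast_lt_top i) isOpen_Ioo.uniqueDiffOn
    have hd' := hd.differentiableAt (isOpen_Ioo.mem_nhds hs)
    refine hd'.congr_of_eventuallyEq ?_
    filter_upwards [isOpen_Ioo.mem_nhds hs] with t ht
    exact (iteratedDerivWithin_of_isOpen isOpen_Ioo ht).symm
  simp only [iteratedDeriv_succ]
  exact h2.hasDerivAt

/-- The core estimate in terms of norms, with a constant for each bound on the coefficient. -/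
lemma mainN (j : ℕ) (M₀ : ℝ) (hM₀ : 0 < M₀) (N : ℕ) : ∃ A : ℝ, 0 ≤ A ∧ ∀ τ u f : ℝ → ℝ,
        ContDiffOn ℝ (⊤ : ℕ∞) τ (Set.Icc 0 1) →
        (∀ s ∈ Set.Icc (0:ℝ) 1, M₀⁻¹ * s ≤ τ s ∧ τ s ≤ M₀ * s) →
        Xnorm (max j 2) (deriv τ) ≤ N →
        ContDiffOn ℝ (⊤ : ℕ∞) f (Set.Ioi 0) →
        Xnorm j f ≠ ⊤ →
        ContDiffOn ℝ (⊤ : ℕ∞) u (Set.Ioi 0) →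
        (∀ s ∈ Set.Ioo (0:ℝ) 1, τ s * deriv u s = ∫ σ in (0:ℝ)..s, f σ) →
        XnormSq (j + 2) u ≤ wL2 0 u ^ 2 + ENNReal.ofReal A * Xnorm j f ^ 2 := by
  set R : ℝ := (6 + 12 * (((max j 2 : ℕ):ℝ)+1)^2) * (N:ℝ)^2 with hR
  set c : ℝ := (6 + 12 * ((j:ℝ)+1)^2) with hc
  have hR0 : 0 ≤ R := by positivity
  have hc0 : 0 ≤ c := by positivity
  have hcore : ∀ i, ∃ A, 0 ≤ A ∧ (i ≤ j + 1 → ∀ V M W K, Dat j M₀⁻¹ R V M W K → Bd (wt ((j:ℝ)/2) i) (V i) (A * K)) := by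
    intro i
    by_cases hi : i ≤ j + 1
    · obtain ⟨A, hA, h⟩ := core j (inv_pos.2 hM₀) hR0 i hi
      exact ⟨A, hA, fun _ => h⟩
    · exact ⟨0, le_rfl, fun h => absurd h hi⟩
  choose A hA hAb using hcore
  refine ⟨∑ i ∈ Finset.range (j+2), A i * c, Finset.sum_nonneg fun i _ => mul_nonneg (hA i) hc0, ?_⟩
  intro τ u f hτ hτb hτN hf hfN hu heq
  have hsub : Set.Ioo (0:ℝ) 1 ⊆ Set.Ioi 0 := fun s hs => hs.1
  have hτ' := hτ.mono Set.Ioo_subset_Icc_self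
  have hu' := hu.mono hsub
  have hf' := hf.mono hsub
  have hdu : ContDiffOn ℝ (⊤ : ℕ∞) (deriv u) (Set.Ioo 0 1) :=
    hu'.deriv_of_isOpen isOpen_Ioo (by simp)
  have hdτ : ContDiffOn ℝ (⊤ : ℕ∞) (deriv τ) (Set.Ioo 0 1) :=
    hτ'.deriv_of_isOpen isOpen_Ioo (by simp)
  have hμ : ContDiffOn ℝ (⊤ : ℕ∞) (fun s => τ s / s) (Set.Ioo 0 1) :=
    hτ'.div contDiffOn_id (fun s hs => hs.1.ne')
  have hW : ContDiffOn ℝ (⊤ : ℕ∞) (fun s => deriv u s * (τ s / s)) (Set.Ioo 0 1) := hdu.mul hμ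
  -- real norm of f
  set n : ℝ := (Xnorm j f).toReal with hn
  have hn0 : 0 ≤ n := ENNReal.toReal_nonneg
  have hnf : Xnorm j f = ENNReal.ofReal n := (ENNReal.ofReal_toReal hfN).symm
  have bf := bd_of_Xnorm hn0 hnf.le
  have bτ := bd_of_Xnorm (Nat.cast_nonneg N) (hτN.trans (by simp))
  have df := dseq_of hf'
  have dτ := dseq_of hdτ
  -- integrability of f
  have hfint : IntegrableOn f (Set.Ioo 0 1) := by
    have h0 : wL2 0 f ^ 2 ≤ ENNReal.ofReal (n^2) := by
      apply wL2_of_bd hf'.continuousOn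
      have := bf 0 (Nat.zero_le _) (df.cont 0)
      rwa [wt_zero_of (by push_cast; positivity), iteratedDeriv_zero] at this
    rw [wL2_sq] at h0
    have hmem : MemLp f 2 (volume.restrict (Set.Ioo (0:ℝ) 1)) := by
      rw [memLp_two_iff_integrable_sq (hf'.continuousOn.aestronglyMeasurable measurableSet_Ioo)]
      refine ⟨(hf'.continuousOn.pow 2).aestronglyMeasurable measurableSet_Ioo, ?_⟩
      rw [hasFiniteIntegral_iff_ofReal (Filter.Eventually.of_forall fun s => sq_nonneg _)]
      refine lt_of_le_of_lt ?_ (h0.trans_lt ENNReal.ofReal_lt_top)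
      simp
    exact hmem.integrable (by norm_num)
  have hfii : ∀ s ∈ Set.Ioo (0:ℝ) 1, IntervalIntegrable f volume 0 s := by
    intro s hs
    rw [intervalIntegrable_iff_integrableOn_Ioc_of_le hs.1.le]
    exact hfint.mono_set fun t ht => ⟨ht.1, ht.2.trans_lt hs.2⟩
  have hF : ∀ s ∈ Set.Ioo (0:ℝ) 1, s * (deriv u s * (τ s / s)) = ∫ σ in (0:ℝ)..s, f σ := by
    intro s hs
    rw [← heq s hs]
    have := hs.1.ne'
    field_simp
  have dat : Dat j M₀⁻¹ R (fun i => iteratedDeriv i (deriv u)) (fun i => iteratedDeriv i (fun s => τ s / s))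
      (fun i => iteratedDeriv i (fun s => deriv u s * (τ s / s))) (c * n^2) := by
    refine ⟨dseq_of hdu, dseq_of hμ, dseq_of hW, ?_, ?_, ?_, ?_⟩
    · intro s hs; simp
    · intro s hs
      simp only [iteratedDeriv_zero]
      rw [le_div_iff₀ hs.1]
      exact (hτb s (Set.Ioo_subset_Icc_self hs)).1
    · refine hardy_seq' (by positivity) (by have : (0:ℝ) ≤ j := Nat.cast_nonneg _
                                            linarith) (dseq_of hW) df ?_ ?_ (fun i hi => bf i hi (df.cont i))
      · intro s hs
        simp only [iteratedDeriv_zero]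
        have h1 : HasDerivAt (fun s => ∫ σ in (0:ℝ)..s, f σ) (f s) s := by
          apply intervalIntegral.integral_hasDerivAt_right (hfii s hs)
          · exact hf'.continuousOn.stronglyMeasurableAtFilter isOpen_Ioo s hs
          · exact hf'.continuousOn.continuousAt (isOpen_Ioo.mem_nhds hs)
        refine h1.congr_of_eventuallyEq ?_
        filter_upwards [isOpen_Ioo.mem_nhds hs] with t ht using hF t ht
      · simp only [iteratedDeriv_zero]
        have h1 : ContinuousOn (fun s => ∫ σ in (0:ℝ)..s, f σ) (Set.uIcc 0 (1/2)) := by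
          apply intervalIntegral.continuousOn_primitive_interval
          rw [Set.uIcc_of_le (by norm_num)]
          rw [integrableOn_Icc_iff_integrableOn_Ioc]
          exact hfint.mono_set fun t ht => ⟨ht.1, ht.2.trans_lt (by norm_num)⟩
        have h2 := h1 0 Set.left_mem_uIcc
        rw [Set.uIcc_of_le (by norm_num)] at h2
        have h3 : Filter.Tendsto (fun s => ∫ σ in (0:ℝ)..s, f σ) (nhdsWithin 0 (Set.Ioi 0)) (nhds 0) := by
          have := h2.tendsto
          simp only [intervalIntegral.integral_same] at this
          refine this.mono_left ?_
          rw [nhdsWithin_le_iff]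
          exact Filter.mem_of_superset (Ioo_mem_nhdsGT (show (0:ℝ) < 1/2 by norm_num)) Set.Ioo_subset_Icc_self
        refine h3.congr' ?_
        filter_upwards [Ioo_mem_nhdsGT (zero_lt_one' ℝ)] with s hs using (hF s hs).symm
    · have hst : ∀ s ∈ Set.Ioo (0:ℝ) 1, s * (τ s / s) = τ s := by
        intro s hs
        have := hs.1.ne'
        field_simp
      refine hardy_seq' (by positivity) (by have : (0:ℝ) ≤ ((max j 2 : ℕ):ℝ) := Nat.cast_nonneg _
                                            linarith) (dseq_of hμ) dτ ?_ ?_ (fun i hi => bτ i hi (dτ.cont i))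
      · intro s hs
        simp only [iteratedDeriv_zero]
        have h1 : HasDerivAt τ (deriv τ s) s :=
          ((hτ'.contDiffAt (isOpen_Ioo.mem_nhds hs)).differentiableAt (by simp)).hasDerivAt
        refine h1.congr_of_eventuallyEq ?_
        filter_upwards [isOpen_Ioo.mem_nhds hs] with t ht using hst t ht
      · simp only [iteratedDeriv_zero]
        have h3 : Filter.Tendsto (fun s => M₀ * s) (nhdsWithin 0 (Set.Ioi 0)) (nhds 0) := by
          have : Continuous (fun s : ℝ => M₀ * s) := by fun_prop
          have := this.tendsto 0
          rw [mul_zero] at this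
          exact this.mono_left nhdsWithin_le_nhds
        refine tendsto_of_tendsto_of_tendsto_of_le_of_le' tendsto_const_nhds h3 ?_ ?_
        · filter_upwards [Ioo_mem_nhdsGT (zero_lt_one' ℝ)] with s hs
          rw [hst s hs]
          exact le_trans (mul_nonneg (inv_pos.2 hM₀).le hs.1.le) (hτb s (Set.Ioo_subset_Icc_self hs)).1
        · filter_upwards [Ioo_mem_nhdsGT (zero_lt_one' ℝ)] with s hs
          rw [hst s hs]
          exact (hτb s (Set.Ioo_subset_Icc_self hs)).2
  rw [XnormSq_eq, Finset.sum_range_succ', add_comm]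
  have hz : wt (((j+2 : ℕ):ℝ)/2) 0 = 0 := wt_zero_of (by push_cast; positivity)
  rw [hz, iteratedDeriv_zero]
  refine add_le_add le_rfl ?_
  rw [ENNReal.ofReal_sum_of_nonneg (fun i _ => mul_nonneg (hA i) hc0), Finset.sum_mul]
  refine Finset.sum_le_sum fun i hi => ?_
  have hi' : i ≤ j + 1 := by have := Finset.mem_range.1 hi; omega
  have hw : wt (((j+2 : ℕ):ℝ)/2) (i+1) = wt ((j:ℝ)/2) i := by
    unfold wt; congr 1; push_cast; ring
  rw [hw, iteratedDeriv_succ']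
  refine (wL2_of_bd ((dseq_of hdu).cont i) (hAb i hi' _ _ _ _ dat)).trans (le_of_eq ?_)
  rw [hnf, ← ENNReal.ofReal_pow hn0, ← ENNReal.ofReal_mul (mul_nonneg (hA i) hc0), mul_assoc]

/-- elliptic regularity for the degenerate operator `u ↦ (τ u')'`:
if `M₀⁻¹ s ≤ τ(s) ≤ M₀ s` and `τ u' = ∫₀^s f`, then
`‖u‖_{X^{j+2}} ≤ ‖u‖_{L²} + C(‖τ'‖_{X^{max(j,2)}}) ‖f‖_{X^j}` with `C` nondecreasing. -/
theorem stmt12 (j : ℕ) (M₀ : ℝ) (hM₀ : 0 < M₀) :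
    ∃ C : ℝ≥0∞ → ℝ≥0∞, (∀ x, 0 < C x) ∧ (∀ x, x ≠ ⊤ → C x ≠ ⊤) ∧ Monotone C ∧
      ∀ τ u f : ℝ → ℝ,
        ContDiffOn ℝ (⊤ : ℕ∞) τ (Set.Icc 0 1) →
        (∀ s ∈ Set.Icc (0:ℝ) 1, M₀⁻¹ * s ≤ τ s ∧ τ s ≤ M₀ * s) →
        Xnorm (max j 2) (deriv τ) ≠ ⊤ →
        ContDiffOn ℝ (⊤ : ℕ∞) f (Set.Ioi 0) →
        Xnorm j f ≠ ⊤ →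
        ContDiffOn ℝ (⊤ : ℕ∞) u (Set.Ioi 0) →
        wL2 0 u ≠ ⊤ →
        (∀ s ∈ Set.Ioo (0:ℝ) 1, τ s * deriv u s = ∫ σ in (0:ℝ)..s, f σ) →
        Xnorm (j + 2) u ≤ wL2 0 u + C (Xnorm (max j 2) (deriv τ)) * Xnorm j f := by
  choose A hA hAb using mainN j M₀ hM₀
  set C : ℝ≥0∞ → ℝ≥0∞ := fun x => if x = ⊤ then ⊤ else
    1 + ∑ n ∈ Finset.range (⌈x.toReal⌉₊ + 1), ENNReal.ofReal (A n) with hC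
  refine ⟨C, ?_, ?_, ?_, ?_⟩
  · intro x
    simp only [hC]
    split_ifs
    · simp
    · exact lt_of_lt_of_le one_pos le_self_add
  · intro x hx
    simp only [hC, if_neg hx]
    exact ENNReal.add_ne_top.2 ⟨by simp, (ENNReal.sum_lt_top.2 fun n _ => ENNReal.ofReal_lt_top).ne⟩
  · intro x y hxy
    simp only [hC]
    by_cases hy : y = ⊤
    · simp [hy]
    · have hx : x ≠ ⊤ := ne_top_of_le_ne_top hy hxy
      rw [if_neg hx, if_neg hy]
      refine add_le_add le_rfl (Finset.sum_le_sum_of_subset ?_)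
      have := Nat.ceil_mono (ENNReal.toReal_mono hy hxy)
      exact Finset.range_mono (by omega)
  · intro τ u f hτ hτb hτN hf hfN hu _ heq
    set x := Xnorm (max j 2) (deriv τ) with hx
    set N := ⌈x.toReal⌉₊ with hN
    have hxN : x ≤ N := by
      rw [← ENNReal.ofReal_toReal hτN, ← ENNReal.ofReal_natCast]
      exact ENNReal.ofReal_le_ofReal (Nat.le_ceil _)
    have key := hAb N τ u f hτ hτb hxN hf hfN hu heq
    have hCx : 1 + ENNReal.ofReal (A N) ≤ C x := by
      simp only [hC, if_neg hτN]
      exact add_le_add le_rfl (Finset.single_le_sum (f := fun n => ENNReal.ofReal (A n))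
        (fun _ _ => zero_le) (Finset.mem_range.2 (by omega)))
    refine le_trans ?_ (add_le_add (le_refl (wL2 0 u)) (mul_le_mul_left hCx (Xnorm j f)))
    have hsq : Xnorm (j+2) u = XnormSq (j+2) u ^ ((2:ℝ)⁻¹) := by unfold Xnorm; norm_num
    rw [hsq, ENNReal.rpow_inv_le_iff (by norm_num)]
    refine key.trans ?_
    rw [show (2:ℝ) = ((2:ℕ):ℝ) by norm_num, ENNReal.rpow_natCast]
    set a := wL2 0 u
    set b := Xnorm j f
    set c := ENNReal.ofReal (A N)
    calc a ^ 2 + c * b ^ 2 ≤ a ^ 2 + c * b ^ 2 + (2 * a * ((1 + c) * b) + b^2 + c * b^2 + c^2*b^2) := le_self_add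
      _ = _ := by ring
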